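/- The operators Z₁ = D₁² + D₄² + v(D₁ − D₄) and Z₂ = D₁³ + D₄³ + (1/4)(−v+α+β+4)(v+α+β+2)(D₁² + vD₁) + (1/4)(−v+α+β+2)(v+α+β+4)(D₄² − vD₄) + v(D₁² − D₄²) satisfy the algebraic relation 0 = Z₁³ − Z₂² + ((α+β+4)(α+β+2) − v²)/2 · Z₁Z₂ − (1/16)(v+α+β+2)(−v+α+β+2)(v+α+β+4)(−v+α+β+4) · Z₁², as an identity of right-acting operators on Mat₂(ℂ[x]), i.e. the corresponding combination of composites annihilates every P ∈ Mat₂(ℂ[x]). -/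

import Mathlib

open Polynomial

/-- 2×2 matrix polynomials with complex coefficients. -/
abbrev MatPoly2 := Matrix (Fin 2) (Fin 2) (Polynomial ℂ)

/-- Entrywise derivative of a matrix polynomial. -/
noncomputable def matDeriv (P : MatPoly2) : MatPoly2 := Matrix.of fun i j => derivative (P i j)

/-- First-order coefficient of the operator `𝒱`. -/
noncomputable def V1 (α β v : ℂ) : MatPoly2 :=
  !![X + C ((β - α) / v), C (1 + (β - α) / v);
     C (1 + (α - β) / v), X + C ((α - β) / v)]

/-- Zeroth-order coefficient of the operator `𝒱`. -/
noncomputable def V0 (α β v : ℂ) : MatPoly2 :=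
  !![C ((v + α + β + 2) / 2), 0;
     0, C ((-v + α + β + 2) / 2)]

/-- First-order coefficient of the operator `𝒩`. -/
noncomputable def N1 (α β v : ℂ) : MatPoly2 :=
  !![-X + C ((β - α) / v), C (1 + (β - α) / v);
     C (1 + (α - β) / v), -X + C ((α - β) / v)]

/-- Zeroth-order coefficient of the operator `𝒩`. -/
noncomputable def N0 (α β v : ℂ) : MatPoly2 :=
  !![C (-(-v + α + β + 4) / 2), 0;
     0, C (-(v + α + β + 4) / 2)]

/-- The right action of `𝒱`: `P·𝒱 = P′ V₁ + P V₀`. -/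
noncomputable def actV (α β v : ℂ) (P : MatPoly2) : MatPoly2 :=
  matDeriv P * V1 α β v + P * V0 α β v

/-- The right action of `𝒩`: `P·𝒩 = P′ N₁ + P N₀`. -/
noncomputable def actN (α β v : ℂ) (P : MatPoly2) : MatPoly2 :=
  matDeriv P * N1 α β v + P * N0 α β v

/-- The elementary matrix `E₁₁`. -/
noncomputable def E11 : Matrix (Fin 2) (Fin 2) ℂ := !![1, 0; 0, 0]
/-- The elementary matrix `E₁₂`. -/
noncomputable def E12 : Matrix (Fin 2) (Fin 2) ℂ := !![0, 1; 0, 0]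
/-- The elementary matrix `E₂₁`. -/
noncomputable def E21 : Matrix (Fin 2) (Fin 2) ℂ := !![0, 0; 1, 0]
/-- The elementary matrix `E₂₂`. -/
noncomputable def E22 : Matrix (Fin 2) (Fin 2) ℂ := !![0, 0; 0, 1]

/-- The right action of the operator `𝒩M𝒱` for a constant matrix `M`:
`P·(𝒩M𝒱) = ((P·𝒩)M)·𝒱`.  Taking `M = E₁₁, E₁₂, E₂₁, E₂₂` gives the operators
`D₁, D₂, D₃, D₄`. -/
noncomputable def actD (α β v : ℂ) (M : Matrix (Fin 2) (Fin 2) ℂ) (P : MatPoly2) : MatPoly2 :=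
  actV α β v (actN α β v P * M.map C)

/-- The right action of the central operator `Z₁ = D₁² + D₄² + v(D₁ − D₄)`. -/
noncomputable def actZ1 (α β v : ℂ) (P : MatPoly2) : MatPoly2 :=
  actD α β v E11 (actD α β v E11 P) + actD α β v E22 (actD α β v E22 P)
    + v • (actD α β v E11 P - actD α β v E22 P)

/-- The right action of the central operator
`Z₂ = D₁³ + D₄³ + (1/4)(−v+α+β+4)(v+α+β+2)(D₁² + vD₁)
      + (1/4)(−v+α+β+2)(v+α+β+4)(D₄² − vD₄) + v(D₁² − D₄²)`. -/
noncomputable def actZ2 (α β v : ℂ) (P : MatPoly2) : MatPoly2 :=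
  actD α β v E11 (actD α β v E11 (actD α β v E11 P))
    + actD α β v E22 (actD α β v E22 (actD α β v E22 P))
    + ((-v + α + β + 4) * (v + α + β + 2) / 4) •
        (actD α β v E11 (actD α β v E11 P) + v • actD α β v E11 P)
    + ((-v + α + β + 2) * (v + α + β + 4) / 4) •
        (actD α β v E22 (actD α β v E22 P) - v • actD α β v E22 P)
    + v • (actD α β v E11 (actD α β v E11 P) - actD α β v E22 (actD α β v E22 P))

theorem matDeriv_add (P Q : MatPoly2) : matDeriv (P + Q) = matDeriv P + matDeriv Q := by
  ext1 i j
  simp [matDeriv]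

theorem matDeriv_smul (c : ℂ) (P : MatPoly2) : matDeriv (c • P) = c • matDeriv P := by
  ext1 i j
  simp [matDeriv]

/-- The operator `𝒩M𝒱` as a linear endomorphism of the space of matrix polynomials. -/
noncomputable def endD (α β v : ℂ) (M : Matrix (Fin 2) (Fin 2) ℂ) : Module.End ℂ MatPoly2 where
  toFun := actD α β v M
  map_add' P Q := by
    simp only [actD, actV, actN, matDeriv_add, add_mul]
    abel
  map_smul' c P := by
    simp only [actD, actV, actN, matDeriv_smul, smul_mul_assoc, ← smul_add, RingHom.id_apply]

theorem endD_apply (α β v : ℂ) (M : Matrix (Fin 2) (Fin 2) ℂ) (P : MatPoly2) :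
    endD α β v M P = actD α β v M P := rfl

theorem actN_actV_E22_mul_E11 (α β v : ℂ) (Q : MatPoly2) :
    actN α β v (actV α β v (Q * E22.map C)) * E11.map C = 0 := by
  have ha : (α - β) / v = -((β - α) / v) := by ring
  have h2 : C (2⁻¹ : ℂ) * 2 = 1 := by
    rw [← C_ofNat, ← C_mul]
    simp
  ext1 i j
  fin_cases j
  · simp [actN, actV, matDeriv, V1, V0, N1, N0, E11, E22, ha, Matrix.mul_apply,
      div_eq_mul_inv, C_ofNat]
    linear_combination (-derivative (Q i 1) * (1 - (C β - C α) * C v⁻¹)) * h2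
  · simp [E11, E22, Matrix.mul_apply]

theorem actN_actV_E11_mul_E22 (α β v : ℂ) (Q : MatPoly2) :
    actN α β v (actV α β v (Q * E11.map C)) * E22.map C = 0 := by
  have ha : (α - β) / v = -((β - α) / v) := by ring
  have h2 : C (2⁻¹ : ℂ) * 2 = 1 := by
    rw [← C_ofNat, ← C_mul]
    simp
  ext1 i j
  fin_cases j
  · simp [E11, E22, Matrix.mul_apply]
  · simp [actN, actV, matDeriv, V1, V0, N1, N0, E11, E22, ha, Matrix.mul_apply,
      div_eq_mul_inv, C_ofNat]
    linear_combination (-derivative (Q i 0) * (1 + (C β - C α) * C v⁻¹)) * h2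

theorem actV_zero (α β v : ℂ) : actV α β v 0 = 0 := by
  have h : matDeriv 0 = 0 := by
    ext1 i j
    simp [matDeriv]
  simp [actV, h]

theorem endD_E11_mul_endD_E22 (α β v : ℂ) : endD α β v E11 * endD α β v E22 = 0 := by
  refine LinearMap.ext fun P => ?_
  change actV α β v (actN α β v (actV α β v (actN α β v P * E22.map C)) * E11.map C) = 0
  rw [actN_actV_E22_mul_E11, actV_zero]

theorem endD_E22_mul_endD_E11 (α β v : ℂ) : endD α β v E22 * endD α β v E11 = 0 := by
  refine LinearMap.ext fun P => ?_
  change actV α β v (actN α β v (actV α β v (actN α β v P * E11.map C)) * E22.map C) = 0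
  rw [actN_actV_E11_mul_E22, actV_zero]

/-- The relation between two central elements built from a pair `x`, `y` of elements with
`x * y = 0` and `y * x = 0`. -/
theorem cubic_relation_of_mul_eq_zero {A : Type*} [Ring A] [Module ℂ A]
    [IsScalarTower ℂ A A] [SMulCommClass ℂ A A] {x y : A}
    (hxy : x * y = 0) (hyx : y * x = 0) (v c d : ℂ) (hcd : c - d = v) (z w : A)
    (hz : z = x * x + y * y + v • (x - y))
    (hw : w = x * (x * x) + y * (y * y) + c • (x * x + v • x) + d • (y * y - v • y)
      + v • (x * x - y * y)) :
    z * (z * z) - w * w + (c + d) • (w * z) - (c * d) • (z * z) = 0 := by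
  subst hz hw
  obtain rfl : c = d + v := by linear_combination hcd
  have hxy' (t : A) : x * (y * t) = 0 := by rw [← mul_assoc, hxy, zero_mul]
  have hyx' (t : A) : y * (x * t) = 0 := by rw [← mul_assoc, hyx, zero_mul]
  simp only [mul_add, add_mul, mul_sub, sub_mul, smul_mul_assoc, mul_smul_comm, mul_assoc, hxy,
    hyx, hxy', hyx', mul_zero, smul_zero, add_zero, zero_add, sub_zero, zero_sub, smul_add,
    smul_sub, mul_neg, smul_neg]
  module

/-- The operator `Z₁` as a linear endomorphism. -/
noncomputable def endZ1 (α β v : ℂ) : Module.End ℂ MatPoly2 :=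
  endD α β v E11 * endD α β v E11 + endD α β v E22 * endD α β v E22
    + v • (endD α β v E11 - endD α β v E22)

/-- The operator `Z₂` as a linear endomorphism. -/
noncomputable def endZ2 (α β v : ℂ) : Module.End ℂ MatPoly2 :=
  endD α β v E11 * (endD α β v E11 * endD α β v E11)
    + endD α β v E22 * (endD α β v E22 * endD α β v E22)
    + ((-v + α + β + 4) * (v + α + β + 2) / 4) •
        (endD α β v E11 * endD α β v E11 + v • endD α β v E11)
    + ((-v + α + β + 2) * (v + α + β + 4) / 4) •
        (endD α β v E22 * endD α β v E22 - v • endD α β v E22)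
    + v • (endD α β v E11 * endD α β v E11 - endD α β v E22 * endD α β v E22)

theorem endZ1_apply (α β v : ℂ) (P : MatPoly2) : endZ1 α β v P = actZ1 α β v P := by
  simp only [endZ1, actZ1, LinearMap.add_apply, LinearMap.sub_apply, LinearMap.smul_apply,
    Module.End.mul_apply, endD_apply]

theorem endZ2_apply (α β v : ℂ) (P : MatPoly2) : endZ2 α β v P = actZ2 α β v P := by
  simp only [endZ2, actZ2, LinearMap.add_apply, LinearMap.sub_apply, LinearMap.smul_apply,
    Module.End.mul_apply, endD_apply]

/-- **Algebraic relation between the central generators:**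
`0 = Z₁³ − Z₂² + ((α+β+4)(α+β+2) − v²)/2 · Z₁Z₂
   − (1/16)(v+α+β+2)(−v+α+β+2)(v+α+β+4)(−v+α+β+4) · Z₁²`
as right-acting operators on `Mat₂(ℂ[x])`. -/
theorem center_relation (α β v : ℂ) (hv : v ≠ 0) (P : MatPoly2) :
    actZ1 α β v (actZ1 α β v (actZ1 α β v P)) - actZ2 α β v (actZ2 α β v P)
      + (((α + β + 4) * (α + β + 2) - v ^ 2) / 2) • actZ2 α β v (actZ1 α β v P)
      - ((v + α + β + 2) * (-v + α + β + 2) * (v + α + β + 4) * (-v + α + β + 4) / 16) •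
          actZ1 α β v (actZ1 α β v P)
      = 0 := by
  have h := cubic_relation_of_mul_eq_zero (endD_E11_mul_endD_E22 α β v)
    (endD_E22_mul_endD_E11 α β v) v ((-v + α + β + 4) * (v + α + β + 2) / 4)
    ((-v + α + β + 2) * (v + α + β + 4) / 4) (by ring) (endZ1 α β v)
    (endZ2 α β v) (by rw [endZ1]) (by rw [endZ2])
  have h1 : (-v + α + β + 4) * (v + α + β + 2) / 4 + (-v + α + β + 2) * (v + α + β + 4) / 4 =
      ((α + β + 4) * (α + β + 2) - v ^ 2) / 2 := by ring
  have h2 : (-v + α + β + 4) * (v + α + β + 2) / 4 * ((-v + α + β + 2) * (v + α + β + 4) / 4) =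
      (v + α + β + 2) * (-v + α + β + 2) * (v + α + β + 4) * (-v + α + β + 4) / 16 := by ring
  rw [h1, h2] at h
  simpa only [LinearMap.sub_apply, LinearMap.add_apply, LinearMap.smul_apply,
    Module.End.mul_apply, endZ1_apply, endZ2_apply, LinearMap.zero_apply]
    using LinearMap.congr_fun h P
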